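/- Let l be an even positive integer, let r, q be integers with 0 < 2r < q and gcd(q, r) = 1, and set p = l·q − r. Let a, m, k, α be integers with k ≥ 0 and α ∈ {0, 1}, and suppose (1−α)·p + q − 1 is even. Set i_k = ((1−α)·p + q − 1)/2 + k·(a·l − m·p) and j_k = (−(1−α)·r + q − 1)/2 + k·(a·l − m·p). Assume 0 ≤ i_k < p + q, 0 ≤ i_k + a < p + q, 0 ≤ j_k < q, and 0 ≤ j_k + a − m·q < q. Then d(p, q, i_k + a) − d(p, q, i_k) = (2·(a·l − m·p)²/(p·r))·k + (l/(p·r))·(a − m·p/l)² + m²/l − m·α − d(r, q mod r, j_k + a − m·q) + d(r, q mod r, j_k). -/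

import Mathlib

/-- The Ozsváth–Szabó correction term `d(L(p,q), i)` of the lens space `L(p,q)`,
defined for `p > q ≥ 0` coprime by the recursion `d(1,0,i) = 0` and
`d(p,q,i) = -1/4 + (2 i₀ + 1 - p - q)²/(4pq) - d(q, p mod q, i₀)` where
`i₀ = i mod p`. -/
def dCorr : ℕ → ℕ → ℤ → ℚ
  | _, 0, _ => 0
  | p, q + 1, i =>
    -1/4 + (2 * ((i % (p : ℤ) : ℤ) : ℚ) + 1 - (p : ℚ) - ((q + 1 : ℕ) : ℚ)) ^ 2
        / (4 * (p : ℚ) * ((q + 1 : ℕ) : ℚ))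
      - dCorr (q + 1) (p % (q + 1)) (i % (p : ℤ))
  termination_by p q _ => q
  decreasing_by exact Nat.lt_succ_of_le (Nat.le_of_lt_succ (Nat.mod_lt _ (Nat.succ_pos q)))

theorem dCorr_emod (p q : ℕ) (i : ℤ) : dCorr p q (i % (p : ℤ)) = dCorr p q i := by
  cases q with
  | zero => simp [dCorr]
  | succ q => rw [dCorr, dCorr, Int.emod_emod_of_dvd _ dvd_rfl]

theorem dCorr_congr {p q : ℕ} {i j : ℤ} (h : i ≡ j [ZMOD p]) : dCorr p q i = dCorr p q j := by
  rw [← dCorr_emod p q i, ← dCorr_emod p q j, h]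

theorem dCorr_of_lt {p q : ℕ} (hq : 0 < q) {i : ℤ} (hi : 0 ≤ i) (hip : i < p) :
    dCorr p q i = -1/4 + (2 * (i : ℚ) + 1 - p - q) ^ 2 / (4 * p * q) - dCorr q (p % q) i := by
  obtain ⟨q, rfl⟩ := Nat.exists_eq_succ_of_ne_zero hq.ne'
  rw [dCorr, Int.emod_eq_of_lt hi hip]

/-- Translating the label of `L(p,q)` by `q` changes the correction term by `(2i + 1 - p)/p`. -/
theorem dCorr_add_sub (p q : ℕ) (hqp : q < p) (hc : Nat.Coprime p q) (i : ℤ)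
    (hi : 0 ≤ i) (hip : i < p) :
    dCorr p q (i + q) - dCorr p q i = (2 * (i : ℚ) + 1 - p) / p := by
  induction q using Nat.strong_induction_on generalizing p i with
  | _ q ih =>
  have hp0 : (p : ℚ) ≠ 0 := by
    have : p ≠ 0 := by omega
    exact_mod_cast this
  rcases Nat.eq_zero_or_pos q with rfl | hq
  · have hp1 : p = 1 := by simpa using hc
    subst hp1
    have hi0 : i = 0 := by omega
    subst hi0
    simp
  have hq0 : (q : ℚ) ≠ 0 := by exact_mod_cast hq.ne'
  rcases lt_or_ge (i + q) (p : ℤ) with h | h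
  · rw [dCorr_of_lt hq (by omega) h, dCorr_of_lt hq hi hip,
      dCorr_congr (p := q) (i := i + q) (j := i) (by simp [Int.ModEq])]
    push_cast
    field_simp
    ring
  · obtain ⟨j, rfl⟩ : ∃ j, i = j + p - q := ⟨i + q - p, by ring⟩
    have hrec := ih (p % q) (Nat.mod_lt p hq) q (Nat.mod_lt p hq)
      (Nat.Coprime.symm ((Nat.gcd_rec q p).symm.trans hc.symm))
      j (by omega) (by omega)
    have e1 : dCorr p q (j + p - q + q) = dCorr p q j :=
      dCorr_congr (by simp [Int.ModEq])
    have e2 : dCorr q (p % q) (j + p - q) = dCorr q (p % q) (j + (p % q : ℕ)) :=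
      dCorr_congr (by simp [Int.ModEq])
    rw [e1, dCorr_of_lt hq (by omega) (by omega : j < p), dCorr_of_lt hq hi hip, e2]
    rw [sub_eq_iff_eq_add] at hrec
    rw [hrec]
    push_cast
    field_simp
    ring

/-- The recursion for `d(L(p,q), i)` holds without reducing `i` modulo `p` as long as
`0 ≤ i < p + q`. -/
theorem dCorr_of_lt_add {p q : ℕ} (hq : 0 < q) (hqp : q < p) (hc : Nat.Coprime p q) {i : ℤ}
    (hi : 0 ≤ i) (hipq : i < (p : ℤ) + q) :
    dCorr p q i = -1/4 + (2 * (i : ℚ) + 1 - p - q) ^ 2 / (4 * p * q) - dCorr q (p % q) i := by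
  rcases lt_or_ge i (p : ℤ) with h | h
  · exact dCorr_of_lt hq hi h
  obtain ⟨j, rfl⟩ : ∃ j, i = j + p := ⟨i - p, by ring⟩
  have hp0 : (p : ℚ) ≠ 0 := by
    have : p ≠ 0 := by omega
    exact_mod_cast this
  have hq0 : (q : ℚ) ≠ 0 := by exact_mod_cast hq.ne'
  have hshift := dCorr_add_sub q (p % q) (Nat.mod_lt p hq)
    (Nat.Coprime.symm ((Nat.gcd_rec q p).symm.trans hc.symm))
    j (by omega) (by omega)
  have e1 : dCorr p q (j + p) = dCorr p q j := dCorr_congr (by simp [Int.ModEq])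
  have e2 : dCorr q (p % q) (j + p) = dCorr q (p % q) (j + (p % q : ℕ)) :=
    dCorr_congr (by simp [Int.ModEq])
  rw [sub_eq_iff_eq_add] at hshift
  rw [e1, e2, hshift, dCorr_of_lt hq (by omega) (by omega : j < p)]
  push_cast
  field_simp
  ring

/-- Three steps of the recursion, from `L(lq - r, q)` through `L(q, q - r)` and `L(q - r, r)`,
down to `L(r, q mod r)`. -/
theorem dCorr_three_steps {p q r l : ℕ} (hl : 2 ≤ l) (hr : 0 < r) (hrq : 2 * r < q)
    (hc : Nat.Coprime q r) (hp : (p : ℤ) = (l : ℤ) * q - r) {i j : ℤ}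
    (hi : 0 ≤ i) (hipq : i < (p : ℤ) + q) (hj : 0 ≤ j) (hjq : j < q) (hij : i ≡ j [ZMOD q]) :
    dCorr p q i = -1/4 + (2 * (i : ℚ) + 1 - p - q) ^ 2 / (4 * p * q)
      + (2 * (j : ℚ) + 1 - q) ^ 2 / (4 * q * r) - (2 * (j : ℚ) + 1 - q) / (2 * q)
      + (r - q) / (4 * q) + (2 * (j : ℚ) + 1 - q) / q
      - dCorr r (q % r) j := by
  obtain ⟨s, rfl⟩ : ∃ s, q = s + r := ⟨q - r, by omega⟩
  obtain ⟨n, rfl⟩ : ∃ n, l = n + 2 := ⟨l - 2, by omega⟩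
  have hp' : p = s + (s + r) * (n + 1) := by
    zify
    rw [hp]
    push_cast
    ring
  have hsr : Nat.Coprime s r := by simpa using hc
  have hps : p % (s + r) = s := by
    rw [hp', Nat.add_mul_mod_self_left, Nat.mod_eq_of_lt (by omega)]
  have hpq : Nat.Coprime p (s + r) := by
    rw [hp', Nat.coprime_add_mul_left_left]
    simpa using hsr
  have hqp : s + r < p := by
    rw [hp']
    nlinarith
  have hqs : (s + r) % s = r := by
    rw [Nat.add_mod_left, Nat.mod_eq_of_lt (by omega)]
  have hqr : (s + r) % r = s % r := Nat.add_mod_right s r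
  have hr0 : (r : ℚ) ≠ 0 := by exact_mod_cast hr.ne'
  have hs0 : (s : ℚ) ≠ 0 := by
    have : s ≠ 0 := by omega
    exact_mod_cast this
  have hq0 : (s : ℚ) + r ≠ 0 := by positivity
  rw [dCorr_of_lt_add (by omega) hqp hpq hi hipq, hps, dCorr_congr hij,
    dCorr_of_lt_add (by omega) (by omega) (by simpa using hsr.symm) hj (by omega), hqs,
    dCorr_of_lt_add hr (by omega) hsr hj (by push_cast at hjq; exact hjq), hqr]
  push_cast
  generalize (2 * (i : ℚ) + 1 - p - (s + r)) ^ 2 / (4 * p * (s + r)) = x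
  field_simp
  ring

/-- The `ζ = -1` telescoped correction-term computation in the proof of Lemma 3.3:
with `p = lq - r`,
`d(p,q,i_k+a) - d(p,q,i_k) = (2(al-mp)²/(pr))k + (l/(pr))(a - mp/l)² + m²/l - mα
  - d(r, q mod r, j_k + a - mq) + d(r, q mod r, j_k)`. -/
theorem dCorr_telescoped_minus (l r q : ℕ) (hl : 0 < l) (hleven : Even l)
    (hr : 0 < r) (hrq : 2 * r < q) (hgcd : Nat.Coprime q r)
    (p : ℕ) (hp : (p : ℤ) = (l : ℤ) * q - r)
    (a m k α : ℤ) (hk : 0 ≤ k) (hα : α = 0 ∨ α = 1)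
    (hpar : Even ((1 - α) * (p : ℤ) + (q : ℤ) - 1))
    (ik jk : ℤ)
    (hik : ik = ((1 - α) * (p : ℤ) + (q : ℤ) - 1) / 2 + k * (a * l - m * p))
    (hjk : jk = (-(1 - α) * (r : ℤ) + (q : ℤ) - 1) / 2 + k * (a * l - m * p))
    (h1 : 0 ≤ ik) (h2 : ik < (p : ℤ) + q) (h3 : 0 ≤ ik + a) (h4 : ik + a < (p : ℤ) + q)
    (h5 : 0 ≤ jk) (h6 : jk < (q : ℤ))
    (h7 : 0 ≤ jk + a - m * q) (h8 : jk + a - m * q < (q : ℤ)) :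
    dCorr p q (ik + a) - dCorr p q ik =
      (2 * ((a : ℚ) * l - m * p) ^ 2 / (p * r)) * k
        + ((l : ℚ) / (p * r)) * ((a : ℚ) - m * p / l) ^ 2
        + (m : ℚ) ^ 2 / l - (m : ℚ) * α
        - dCorr r (q % r) (jk + a - m * q) + dCorr r (q % r) jk := by
  have hl2 : 2 ≤ l := by
    obtain ⟨n, rfl⟩ := hleven
    omega
  obtain ⟨n, hn⟩ := hpar
  obtain ⟨t, ht⟩ := hleven
  have hi : ik = n + k * (a * l - m * p) := by omega
  have hpr : (1 - α) * (p : ℤ) = 2 * ((1 - α) * t * q) - (1 - α) * r := by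
    rw [hp, ht]
    push_cast
    ring
  have hj : jk = n - (1 - α) * t * q + k * (a * l - m * p) := by
    rw [hjk]
    congr 1
    rw [neg_mul]
    omega
  have hij : ik - jk = (1 - α) * t * q := by rw [hi, hj]; ring
  have hmod : ik ≡ jk [ZMOD q] :=
    (Int.modEq_iff_dvd.2 ⟨(1 - α) * t, by rw [hij]; ring⟩ : jk ≡ ik [ZMOD q]).symm
  have hmod' : ik + a ≡ jk + a - m * q [ZMOD q] :=
    (Int.modEq_iff_dvd.2 ⟨(1 - α) * t + m, by linear_combination hij⟩ :
      jk + a - m * q ≡ ik + a [ZMOD q]).symm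
  rw [dCorr_three_steps hl2 hr hrq hgcd hp h3 h4 h7 h8 hmod',
    dCorr_three_steps hl2 hr hrq hgcd hp h1 h2 h5 h6 hmod]
  have hpos : (0 : ℤ) < p := by rw [hp]; nlinarith
  have hp0 : (p : ℚ) ≠ 0 := by exact_mod_cast hpos.ne'
  have hr0 : (r : ℚ) ≠ 0 := by exact_mod_cast hr.ne'
  have hq0 : (q : ℚ) ≠ 0 := by
    have : q ≠ 0 := by omega
    exact_mod_cast this
  have hi2 : 2 * (ik : ℚ) = (1 - α) * p + q - 1 + 2 * (k * (a * l - m * p)) := by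
    have : 2 * ik = (1 - α) * p + q - 1 + 2 * (k * (a * l - m * p)) := by
      linear_combination 2 * hi - hn
    exact_mod_cast this
  have hj2 : 2 * (jk : ℚ) = -(1 - α) * r + q - 1 + 2 * (k * (a * l - m * p)) := by
    have : 2 * jk = -(1 - α) * r + q - 1 + 2 * (k * (a * l - m * p)) := by
      linear_combination 2 * hj - hn + hpr
    exact_mod_cast this
  have hlQ : (l : ℚ) = (p + r) / q := by
    have : (p : ℚ) = l * q - r := by exact_mod_cast hp
    rw [this]
    field_simp
    ring
  have hpr0 : (p : ℚ) + r ≠ 0 := by positivity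
  push_cast
  have ei : 2 * ((ik : ℚ) + a) = 2 * ik + 2 * a := by ring
  have ej : 2 * ((jk : ℚ) + a - m * q) = 2 * jk + 2 * (a - m * q) := by ring
  rw [ei, ej, hi2, hj2]
  generalize dCorr r (q % r) (jk + a - m * q) = x
  generalize dCorr r (q % r) jk = y
  rw [hlQ]
  field_simp
  ring
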